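/- For every width w and every bit-vector x : BitVec w with x ≠ 0, the absolute value of the signed interpretation strictly decreases under the update x ↦ (-x) / 2 using truncating signed division: (((-x).sdiv (2 : BitVec w)).toInt.natAbs) < x.toInt.natAbs. -/

import Mathlib

/-- The absolute value of the signed interpretation strictly decreases under
x ↦ (-x) / 2 (truncating signed division), validating the ranking function
R(x) = |x| for `while (x != 0) { x = -x / 2; }`. -/
theorem neg_sdiv_two_abs_lt (w : ℕ) (x : BitVec w) (hx : x ≠ 0) :
    ((-x).sdiv (2 : BitVec w)).toInt.natAbs < x.toInt.natAbs := by
  match w, x, hx with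
  | 0, x, hx => exact absurd BitVec.of_length_zero hx
  | 1, x, hx => revert x; decide
  | 2, x, hx => revert x; decide
  | n + 3, x, hx =>
    have hp : 2 ^ (n + 3) = 8 * 2 ^ n := by ring
    have h1 : 1 ≤ 2 ^ n := Nat.one_le_two_pow
    have h2n : (2 : BitVec (n + 3)).toNat = 2 := by
      change (BitVec.ofNat (n + 3) 2).toNat = 2
      rw [BitVec.toNat_ofNat]
      exact Nat.mod_eq_of_lt (by omega)
    have h2 : (2 : BitVec (n + 3)).toInt = 2 := by
      rw [BitVec.toInt_eq_toNat_cond, h2n, if_pos (by omega)]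
      rfl
    have hne : (2 : BitVec (n + 3)) ≠ -1#(n + 3) := by
      intro h
      have h' := congrArg BitVec.toInt h
      rw [h2, BitVec.toInt_neg_eq_ite] at h'
      have h3 : (1#(n + 3)).toInt = 1 := by
        have h1n : (1#(n + 3)).toNat = 1 := by
          rw [BitVec.toNat_ofNat]
          exact Nat.mod_eq_of_lt (by omega)
        rw [BitVec.toInt_eq_toNat_cond, h1n, if_pos (by omega)]
        rfl
      rw [h3] at h'
      split_ifs at h' <;> omega
    have hx0 : x.toInt ≠ 0 := fun h => hx (BitVec.eq_of_toInt_eq (by rw [h]; simp))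
    have hneg : (-x).toInt.natAbs = x.toInt.natAbs := by
      rw [BitVec.toInt_neg_eq_ite]
      split_ifs <;> simp
    rw [BitVec.toInt_sdiv_of_ne_or_ne _ _ (Or.inr hne), h2, Int.natAbs_tdiv, hneg]
    change x.toInt.natAbs / 2 < _
    omega
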